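/- Let (N,c) be a TU cost game with superadditive characteristic function. Then the allocation x defined by x_i = c({i}) for all i ∈ N satisfies x(S) ≤ c(S) for all S ⊆ N, and it maximizes x(N) over the almost core { x : x(S) ≤ c(S) for all S ⊊ N } (when n ≥ 2). -/

import Mathlib

open Finset

/-- For a superadditive cost game, x_i = c({i}) lies in P(N,c) and maximizes
x(N) over the almost core (when n ≥ 2). -/
theorem superadditive_singleton_allocation {n : ℕ} (hn : 2 ≤ n)
    (c : Finset (Fin n) → ℝ) (hc : ∀ S, 0 ≤ c S) (hc0 : c ∅ = 0)
    (hsuper : ∀ S T : Finset (Fin n), Disjoint S T → c S + c T ≤ c (S ∪ T)) :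
    (∀ S : Finset (Fin n), ∑ i ∈ S, c {i} ≤ c S) ∧
    (∀ y : Fin n → ℝ,
      (∀ S : Finset (Fin n), S ⊂ univ → ∑ i ∈ S, y i ≤ c S) →
      ∑ i, y i ≤ ∑ i, c {i}) := by
  constructor
  · intro S
    induction S using Finset.induction_on with
    | empty => simp [hc0]
    | insert a s ha ih =>
      rw [Finset.sum_insert ha, Finset.insert_eq]
      have h := hsuper {a} s (Finset.disjoint_singleton_left.mpr ha)
      linarith
  · intro y hy
    refine Finset.sum_le_sum fun i _ => ?_
    have h := hy {i} ?_
    · simpa using h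
    · rw [Finset.ssubset_univ_iff]
      intro h
      have h2 := congrArg Finset.card h
      simp at h2
      omega
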